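/- For every ψ : ℝ² → ℂ continuously differentiable on D and every δ with 0 < δ ≤ l one has |Q_L[ψ] − ‖∇ψ‖²| ≤ 4 L_max ( (2/δ) ‖ψ‖² + δ ‖∇ψ‖² ). -/

import Mathlib

open Set MeasureTheory

/-- `ψ` is continuously differentiable on the rectangle `[0,a] × [0,b]`, with
partial derivatives `ψx` and `ψy`. -/
def IsC1OnRect (a b : ℝ) (ψ ψx ψy : ℝ × ℝ → ℂ) : Prop :=
  (∀ p ∈ Set.Icc ((0 : ℝ), (0 : ℝ)) (a, b),
    HasFDerivAt ψ
      ((ContinuousLinearMap.fst ℝ ℝ ℝ).smulRight (ψx p)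
        + (ContinuousLinearMap.snd ℝ ℝ ℝ).smulRight (ψy p)) p) ∧
    ContinuousOn ψx (Set.Icc ((0 : ℝ), (0 : ℝ)) (a, b)) ∧
    ContinuousOn ψy (Set.Icc ((0 : ℝ), (0 : ℝ)) (a, b))

/-- The boundary-value vector `ψ_bv(y) = (ψ(0,y), ψ(l,y), ψ(y,0), ψ(y,l)) ∈ ℂ⁴`. -/
noncomputable def bv (l : ℝ) (ψ : ℝ × ℝ → ℂ) (y : ℝ) : Fin 4 → ℂ :=
  ![ψ (0, y), ψ (l, y), ψ (y, 0), ψ (y, l)]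

/-- The squared `L²` norm `‖∇ψ‖² = ∫_D (|∂ₓψ|² + |∂_yψ|²)` on `D = [0,l]²`. -/
noncomputable def gradNormSq (l : ℝ) (ψx ψy : ℝ × ℝ → ℂ) : ℝ :=
  ∫ x in (0 : ℝ)..l, ∫ y in (0 : ℝ)..l, (‖ψx (x, y)‖ ^ 2 + ‖ψy (x, y)‖ ^ 2)

/-- The squared `L²` norm `‖ψ‖² = ∫_D |ψ|²` on `D = [0,l]²`. -/
noncomputable def normSq (l : ℝ) (ψ : ℝ × ℝ → ℂ) : ℝ :=
  ∫ x in (0 : ℝ)..l, ∫ y in (0 : ℝ)..l, ‖ψ (x, y)‖ ^ 2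

/-- The two-particle quadratic form
`Q_L[ψ] = ‖∇ψ‖² − ∫₀^l ⟨ψ_bv(y), L(y) ψ_bv(y)⟩_{ℂ⁴} dy`. -/
noncomputable def quadForm (l : ℝ) (L : ℝ → Matrix (Fin 4) (Fin 4) ℂ)
    (ψ ψx ψy : ℝ × ℝ → ℂ) : ℝ :=
  gradNormSq l ψx ψy -
    (∫ y in (0 : ℝ)..l,
      ∑ i, (starRingEnd ℂ) (bv l ψ y i) * (L y).mulVec (bv l ψ y) i).re


lemma trace_zero (l δ : ℝ) (hδ0 : 0 < δ) (hδl : δ ≤ l) (f f' : ℝ → ℂ)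
    (hf : ∀ t ∈ Icc (0 : ℝ) l, HasDerivAt f (f' t) t)
    (hf' : ContinuousOn f' (Icc (0 : ℝ) l)) :
    ‖f 0‖ ^ 2 ≤ (2 / δ) * (∫ t in (0 : ℝ)..l, ‖f t‖ ^ 2) + δ * ∫ t in (0 : ℝ)..l, ‖f' t‖ ^ 2 := by
  have hfc : ContinuousOn f (Icc (0 : ℝ) l) :=
    fun t ht => (hf t ht).continuousAt.continuousWithinAt
  have hl : 0 ≤ l := hδ0.le.trans hδl
  have hsub : Icc 0 δ ⊆ Icc 0 l := Icc_subset_Icc_right hδl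
  have hA : ContinuousOn (fun t => ‖f t‖ ^ 2) (Icc 0 l) := hfc.norm.pow 2
  have hB : ContinuousOn (fun t => ‖f' t‖ ^ 2) (Icc 0 l) := hf'.norm.pow 2
  have hAi : IntervalIntegrable (fun t => ‖f t‖ ^ 2) volume 0 l :=
    ContinuousOn.intervalIntegrable_of_Icc hl hA
  have hBi : IntervalIntegrable (fun t => ‖f' t‖ ^ 2) volume 0 l :=
    ContinuousOn.intervalIntegrable_of_Icc hl hB
  have hG : ContinuousOn (fun t => -(1/δ) * ‖f t‖ ^ 2 + (1 - t/δ) * (2 * inner ℝ (f t) (f' t)))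
      (Icc 0 l) := by
    have : ContinuousOn (fun t => inner ℝ (f t) (f' t)) (Icc 0 l) := hfc.inner (𝕜 := ℝ) hf'
    fun_prop
  have hGi := ContinuousOn.intervalIntegrable_of_Icc (μ := volume) hδ0.le (hG.mono hsub)
  have key : ∫ t in (0 : ℝ)..δ, (-(1/δ) * ‖f t‖ ^ 2 + (1 - t/δ) * (2 * inner ℝ (f t) (f' t)))
      = (1 - δ/δ) * ‖f δ‖ ^ 2 - (1 - 0/δ) * ‖f 0‖ ^ 2 := by
    refine intervalIntegral.integral_eq_sub_of_hasDerivAt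
      (f := fun t => (1 - t/δ) * ‖f t‖ ^ 2) ?_ hGi
    intro t ht
    rw [uIcc_of_le hδ0.le] at ht
    have h1 : HasDerivAt (fun t : ℝ => 1 - t/δ) (-(1/δ)) t :=
      ((hasDerivAt_id t).div_const δ).const_sub 1
    exact h1.mul (hf t (hsub ht)).norm_sq
  rw [div_self hδ0.ne'] at key
  have h0 : ‖f 0‖ ^ 2 = ∫ t in (0 : ℝ)..δ,
      -(-(1/δ) * ‖f t‖ ^ 2 + (1 - t/δ) * (2 * inner ℝ (f t) (f' t))) := by
    rw [intervalIntegral.integral_neg, key]; ring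
  have hHi : IntervalIntegrable (fun t => (2 / δ) * ‖f t‖ ^ 2 + δ * ‖f' t‖ ^ 2) volume 0 l :=
    (hAi.const_mul _).add (hBi.const_mul _)
  rw [← intervalIntegral.integral_const_mul, ← intervalIntegral.integral_const_mul,
    ← intervalIntegral.integral_add (hAi.const_mul _) (hBi.const_mul _), h0]
  refine le_trans (intervalIntegral.integral_mono_on hδ0.le hGi.neg
    (hHi.mono_set ?_) ?_) (intervalIntegral.integral_mono_interval le_rfl hδ0.le hδl ?_ hHi)
  · rw [uIcc_of_le hδ0.le, uIcc_of_le hl]; exact hsub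
  · intro t ht
    have hw0 : 0 ≤ 1 - t/δ := by
      have := (div_le_one hδ0).2 ht.2; linarith
    have hw1 : 1 - t/δ ≤ 1 := by
      have := div_nonneg ht.1 hδ0.le; linarith
    have hi : -inner ℝ (f t) (f' t) ≤ ‖f t‖ * ‖f' t‖ :=
      (neg_le_abs _).trans (abs_real_inner_le_norm _ _)
    have h2 : 2 * (‖f t‖ * ‖f' t‖) ≤ (1/δ) * ‖f t‖ ^ 2 + δ * ‖f' t‖ ^ 2 := by
      have : (1/δ) * ‖f t‖ ^ 2 + δ * ‖f' t‖ ^ 2 - 2 * (‖f t‖ * ‖f' t‖)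
        = (1/δ) * (‖f t‖ - δ * ‖f' t‖) ^ 2 := by field_simp; ring
      have : 0 ≤ (1/δ) * (‖f t‖ - δ * ‖f' t‖) ^ 2 := by positivity
      linarith
    have h3 : (1 - t/δ) * (-inner ℝ (f t) (f' t)) ≤ ‖f t‖ * ‖f' t‖ :=
      (mul_le_mul_of_nonneg_left hi hw0).trans (mul_le_of_le_one_left (by positivity) hw1)
    have e : 2/δ = 1/δ + 1/δ := by ring
    rw [e]
    linarith
  · exact Filter.Eventually.of_forall fun t => by simp only [Pi.zero_apply]; positivity

lemma trace_end (l δ : ℝ) (hδ0 : 0 < δ) (hδl : δ ≤ l) (f f' : ℝ → ℂ)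
    (hf : ∀ t ∈ Icc (0 : ℝ) l, HasDerivAt f (f' t) t)
    (hf' : ContinuousOn f' (Icc (0 : ℝ) l)) :
    ‖f l‖ ^ 2 ≤ (2 / δ) * (∫ t in (0 : ℝ)..l, ‖f t‖ ^ 2) + δ * ∫ t in (0 : ℝ)..l, ‖f' t‖ ^ 2 := by
  have hm : ∀ t ∈ Icc (0 : ℝ) l, l - t ∈ Icc (0 : ℝ) l := fun t ht =>
    ⟨by linarith [ht.2], by linarith [ht.1]⟩
  have h := trace_zero l δ hδ0 hδl (fun t => f (l - t)) (fun t => -f' (l - t))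
    (fun t ht => by simpa using (hf _ (hm t ht)).comp_const_sub l t)
    ((hf'.comp (by fun_prop) hm).neg)
  have e1 := intervalIntegral.integral_comp_sub_left (a := 0) (b := l) (fun t => ‖f t‖ ^ 2) l
  have e2 := intervalIntegral.integral_comp_sub_left (a := 0) (b := l) (fun t => ‖f' t‖ ^ 2) l
  simp only [sub_zero, sub_self] at e1 e2
  simp only [sub_zero, norm_neg] at h
  rwa [e1, e2] at h

/-- Extension of a continuous function off the square by clamping. -/
lemma exists_ext (l : ℝ) (hl : 0 ≤ l) (F : ℝ × ℝ → ℂ)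
    (hF : ContinuousOn F (Icc ((0 : ℝ), (0 : ℝ)) (l, l))) :
    ∃ G : ℝ × ℝ → ℝ, Continuous G ∧
      ∀ x ∈ Icc 0 l, ∀ y ∈ Icc 0 l, ‖F (x, y)‖ ^ 2 = G (x, y) := by
  refine ⟨fun p => ‖F (max 0 (min l p.1), max 0 (min l p.2))‖ ^ 2, ?_, ?_⟩
  · refine Continuous.pow (Continuous.norm (hF.comp_continuous (by fun_prop) ?_)) 2
    intro p
    exact ⟨⟨le_max_left _ _, le_max_left _ _⟩,
      ⟨max_le hl (min_le_left _ _), max_le hl (min_le_left _ _)⟩⟩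
  · intro x hx y hy
    simp [hx.1, hx.2, hy.1, hy.2]

lemma form_bound (M : Matrix (Fin 4) (Fin 4) ℂ) (C : ℝ) (v : Fin 4 → ℂ)
    (h : ‖(EuclideanSpace.equiv (Fin 4) ℂ).symm (M.mulVec v)‖
        ≤ C * ‖(EuclideanSpace.equiv (Fin 4) ℂ).symm v‖) :
    ‖∑ i, (starRingEnd ℂ) (v i) * M.mulVec v i‖ ≤ C * ∑ i, ‖v i‖ ^ 2 := by
  have e : ∑ i, (starRingEnd ℂ) (v i) * M.mulVec v i =
      inner ℂ ((EuclideanSpace.equiv (Fin 4) ℂ).symm v)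
        ((EuclideanSpace.equiv (Fin 4) ℂ).symm (M.mulVec v)) := by
    rw [PiLp.inner_apply]
    refine Finset.sum_congr rfl fun i _ => ?_
    simp [mul_comm]
  have e2 : ∑ i, ‖v i‖ ^ 2 = ‖(EuclideanSpace.equiv (Fin 4) ℂ).symm v‖ ^ 2 := by
    rw [EuclideanSpace.norm_sq_eq]; rfl
  rw [e, e2]
  refine (norm_inner_le_norm _ _).trans ?_
  calc _ ≤ ‖(EuclideanSpace.equiv (Fin 4) ℂ).symm v‖ *
        (C * ‖(EuclideanSpace.equiv (Fin 4) ℂ).symm v‖) :=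
      mul_le_mul_of_nonneg_left h (norm_nonneg _)
    _ = _ := by ring

/-- Two-sided estimate for the quadratic form: for `ψ` continuously differentiable
on `D = [0,l]²` and `0 < δ ≤ l`,
`|Q_L[ψ] − ‖∇ψ‖²| ≤ 4 L_max ((2/δ) ‖ψ‖² + δ ‖∇ψ‖²)`, underlying the equivalence
of the form norm with the `H¹(D)` norm. -/
theorem quadForm_H1_equivalence
    (l : ℝ) (hl : 0 < l) (Lmax : ℝ) (hLmax : 0 ≤ Lmax)
    (L : ℝ → Matrix (Fin 4) (Fin 4) ℂ)
    (hmeas : ∀ i j, Measurable fun y => L y i j)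
    (hherm : ∀ᵐ y ∂(volume.restrict (Icc (0 : ℝ) l)), (L y).IsHermitian)
    (hbound : ∀ᵐ y ∂(volume.restrict (Icc (0 : ℝ) l)), ∀ v : Fin 4 → ℂ,
      ‖(EuclideanSpace.equiv (Fin 4) ℂ).symm ((L y).mulVec v)‖
        ≤ Lmax * ‖(EuclideanSpace.equiv (Fin 4) ℂ).symm v‖)
    (ψ ψx ψy : ℝ × ℝ → ℂ) (hC1 : IsC1OnRect l l ψ ψx ψy)
    (δ : ℝ) (hδ0 : 0 < δ) (hδl : δ ≤ l) :
    |quadForm l L ψ ψx ψy - gradNormSq l ψx ψy|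
      ≤ 4 * Lmax * ((2 / δ) * normSq l ψ + δ * gradNormSq l ψx ψy) := by
  obtain ⟨hd, hxc, hyc⟩ := hC1
  have hψc : ContinuousOn ψ (Icc ((0 : ℝ), (0 : ℝ)) (l, l)) :=
    fun p hp => (hd p hp).continuousAt.continuousWithinAt
  have hmem : ∀ x ∈ Icc (0:ℝ) l, ∀ y ∈ Icc (0:ℝ) l, (x, y) ∈ Icc ((0 : ℝ), (0 : ℝ)) (l, l) :=
    fun x hx y hy => ⟨⟨hx.1, hy.1⟩, ⟨hx.2, hy.2⟩⟩
  have hdx : ∀ x ∈ Icc (0:ℝ) l, ∀ y ∈ Icc (0:ℝ) l,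
      HasDerivAt (fun t => ψ (t, y)) (ψx (x, y)) x := by
    intro x hx y hy
    have h := (hd _ (hmem x hx y hy)).comp_hasDerivAt x
      ((hasDerivAt_id x).prodMk (hasDerivAt_const x y))
    simpa [Function.comp_def] using h
  have hdy : ∀ x ∈ Icc (0:ℝ) l, ∀ y ∈ Icc (0:ℝ) l,
      HasDerivAt (fun t => ψ (x, t)) (ψy (x, y)) y := by
    intro x hx y hy
    have h := (hd _ (hmem x hx y hy)).comp_hasDerivAt y
      ((hasDerivAt_const y x).prodMk (hasDerivAt_id y))
    simpa [Function.comp_def] using h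
  have hcx : ∀ y ∈ Icc (0:ℝ) l, ContinuousOn (fun t => ψx (t, y)) (Icc 0 l) := fun y hy =>
    hxc.comp (by fun_prop) (fun t ht => hmem t ht y hy)
  have hcy : ∀ x ∈ Icc (0:ℝ) l, ContinuousOn (fun t => ψy (x, t)) (Icc 0 l) := fun x hx =>
    hyc.comp (by fun_prop) (fun t ht => hmem x hx t ht)
  obtain ⟨A, hA, hAe⟩ := exists_ext l hl.le ψ hψc
  obtain ⟨B, hB, hBe⟩ := exists_ext l hl.le ψx hxc
  obtain ⟨C, hC, hCe⟩ := exists_ext l hl.le ψy hyc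
  have hu : uIcc 0 l = Icc 0 l := uIcc_of_le hl.le
  have eN : normSq l ψ = ∫ x in (0 : ℝ)..l, ∫ y in (0 : ℝ)..l, A (x, y) := by
    refine intervalIntegral.integral_congr fun x hx => intervalIntegral.integral_congr fun y hy => ?_
    rw [hu] at hx hy
    exact hAe x hx y hy
  have hB1 : Continuous fun x => ∫ y in (0 : ℝ)..l, B (x, y) := by fun_prop
  have hC1 : Continuous fun x => ∫ y in (0 : ℝ)..l, C (x, y) := by fun_prop
  have hA1 : Continuous fun x => ∫ y in (0 : ℝ)..l, A (x, y) := by fun_prop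
  have hA2 : Continuous fun y => ∫ x in (0 : ℝ)..l, A (x, y) := by fun_prop
  have hB2 : Continuous fun y => ∫ x in (0 : ℝ)..l, B (x, y) := by fun_prop
  have eG : gradNormSq l ψx ψy = (∫ x in (0 : ℝ)..l, ∫ y in (0 : ℝ)..l, B (x, y)) +
      ∫ x in (0 : ℝ)..l, ∫ y in (0 : ℝ)..l, C (x, y) := by
    rw [← intervalIntegral.integral_add (hB1.intervalIntegrable _ _) (hC1.intervalIntegrable _ _)]
    refine intervalIntegral.integral_congr fun x hx => ?_
    rw [← intervalIntegral.integral_add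
      (Continuous.intervalIntegrable (by fun_prop) _ _)
      (Continuous.intervalIntegrable (by fun_prop) _ _)]
    refine intervalIntegral.integral_congr fun y hy => ?_
    rw [hu] at hx hy
    simp only [hBe x hx y hy, hCe x hx y hy]
  have swap : ∀ F : ℝ × ℝ → ℝ, Continuous F →
      ∫ y in (0 : ℝ)..l, ∫ x in (0 : ℝ)..l, F (x, y) =
        ∫ x in (0 : ℝ)..l, ∫ y in (0 : ℝ)..l, F (x, y) := by
    intro F hF
    simp only [intervalIntegral.integral_of_le hl.le]
    refine (integral_integral_swap (f := fun x y => F (x, y)) ?_).symm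
    rw [Measure.prod_restrict]
    have : IntegrableOn F (Icc 0 l ×ˢ Icc 0 l) (volume.prod volume) :=
      hF.continuousOn.integrableOn_compact (isCompact_Icc.prod isCompact_Icc)
    exact this.mono_set (prod_mono Ioc_subset_Icc_self Ioc_subset_Icc_self)
  have hBnn : 0 ≤ ∫ x in (0 : ℝ)..l, ∫ y in (0 : ℝ)..l, B (x, y) :=
    intervalIntegral.integral_nonneg hl.le fun x hx => intervalIntegral.integral_nonneg hl.le
      fun y hy => by rw [← hBe x hx y hy]; positivity
  have hCnn : 0 ≤ ∫ x in (0 : ℝ)..l, ∫ y in (0 : ℝ)..l, C (x, y) :=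
    intervalIntegral.integral_nonneg hl.le fun x hx => intervalIntegral.integral_nonneg hl.le
      fun y hy => by rw [← hCe x hx y hy]; positivity
  have cg : ∀ f g : ℝ → ℝ, (∀ t ∈ Icc 0 l, f t = g t) →
      ∫ t in (0 : ℝ)..l, f t = ∫ t in (0 : ℝ)..l, g t := fun f g h =>
    intervalIntegral.integral_congr fun t ht => h t (hu ▸ ht)
  -- pointwise trace bound
  have hbv : ∀ y ∈ Icc (0:ℝ) l, ∑ i, ‖bv l ψ y i‖ ^ 2 ≤
      2 * ((2/δ) * (∫ x in (0 : ℝ)..l, A (x, y)) + δ * ∫ x in (0 : ℝ)..l, B (x, y)) +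
      2 * ((2/δ) * (∫ x in (0 : ℝ)..l, A (y, x)) + δ * ∫ x in (0 : ℝ)..l, C (y, x)) := by
    intro y hy
    have h1 := trace_zero l δ hδ0 hδl _ _ (fun t ht => hdx t ht y hy) (hcx y hy)
    have h2 := trace_end l δ hδ0 hδl _ _ (fun t ht => hdx t ht y hy) (hcx y hy)
    have h3 := trace_zero l δ hδ0 hδl _ _ (fun t ht => hdy y hy t ht) (hcy y hy)
    have h4 := trace_end l δ hδ0 hδl _ _ (fun t ht => hdy y hy t ht) (hcy y hy)
    rw [cg _ _ fun t ht => hAe t ht y hy, cg _ _ fun t ht => hBe t ht y hy] at h1 h2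
    rw [cg _ _ fun t ht => hAe y hy t ht, cg _ _ fun t ht => hCe y hy t ht] at h3 h4
    simp only [Fin.sum_univ_four, bv, Matrix.cons_val]
    linarith
  have hI : ‖∫ y in (0 : ℝ)..l,
      ∑ i, (starRingEnd ℂ) (bv l ψ y i) * (L y).mulVec (bv l ψ y) i‖ ≤
      ∫ y in (0 : ℝ)..l, Lmax *
      (2 * ((2/δ) * (∫ x in (0 : ℝ)..l, A (x, y)) + δ * ∫ x in (0 : ℝ)..l, B (x, y)) +
      2 * ((2/δ) * (∫ x in (0 : ℝ)..l, A (y, x)) + δ * ∫ x in (0 : ℝ)..l, C (y, x))) := by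
    refine intervalIntegral.norm_integral_le_of_norm_le hl.le ?_
      (Continuous.intervalIntegrable (by fun_prop) _ _)
    filter_upwards [(ae_restrict_iff' measurableSet_Icc).1 hbound] with y hy hy'
    have hy2 := Ioc_subset_Icc_self hy'
    exact (form_bound _ _ _ (hy hy2 _)).trans (mul_le_mul_of_nonneg_left (hbv y hy2) hLmax)
  have ii : ∀ {f : ℝ → ℝ}, Continuous f → IntervalIntegrable f volume 0 l :=
    fun h => h.intervalIntegrable _ _
  rw [intervalIntegral.integral_const_mul,
    intervalIntegral.integral_add (ii (by fun_prop)) (ii (by fun_prop)),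
    intervalIntegral.integral_const_mul, intervalIntegral.integral_const_mul,
    intervalIntegral.integral_add (ii (by fun_prop)) (ii (by fun_prop)),
    intervalIntegral.integral_add (ii (by fun_prop)) (ii (by fun_prop)),
    intervalIntegral.integral_const_mul, intervalIntegral.integral_const_mul,
    intervalIntegral.integral_const_mul, intervalIntegral.integral_const_mul,
    swap A hA, swap B hB, ← eN] at hI
  rw [quadForm, sub_sub_cancel_left, abs_neg]
  refine (Complex.abs_re_le_norm _).trans (hI.trans ?_)
  rw [eG, mul_comm 4 Lmax, mul_assoc]
  refine mul_le_mul_of_nonneg_left ?_ hLmax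
  have := mul_nonneg hδ0.le hBnn
  have := mul_nonneg hδ0.le hCnn
  linarith
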